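/- (Theorem 3 of the paper: safety and performance loss of the robust solution.) Assume Assumption 1 holds, let U(P̂, e) be the set of all transition kernels P with ∑_{x'} |P x a x' − P̂ x a x'| ≤ e x a for all x, a, and for a policy π define its robust return ρ_rob(π) as the infimum (Real.sInf) of the set {ρ(π, P, r) : P ∈ U(P̂, e)} (this set is nonempty since P̂ ∈ U(P̂, e), and bounded below by −Rmax/(1−γ)). Let π0 be a policy with ρ_rob(π0) ≥ ρ_rob(π) for every policy π, let π⋆ be a policy maximizing the true return, i.e., ρ(π⋆, P⋆, r) ≥ ρ(π, P⋆, r) for every policy π, and let π_B be any (baseline) policy. If ρ_rob(π0) > ρ(π_B, P⋆, r), then: (i) ρ(π0, P⋆, r) ≥ ρ(π_B, P⋆, r); and (ii) ρ(π⋆, P⋆, r) − ρ(π0, P⋆, r) ≤ min{ (2·γ·Rmax/(1−γ)²) · ∑_x u^{π⋆}_{P⋆} x · e_{π⋆} x , ρ(π⋆, P⋆, r) − ρ(π_B, P⋆, r) }. -/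

import Mathlib

open Matrix

/-- The row-stochastic matrix induced by a policy `π` from a transition kernel `P`. -/
noncomputable def polMat {X A : Type*} [Fintype A]
    (P : X → A → X → ℝ) (π : X → A → ℝ) : Matrix X X ℝ :=
  Matrix.of fun x x' => ∑ a, π x a * P x a x'

/-- The reward vector induced by a policy `π` from a reward function `r`. -/
noncomputable def polRew {X A : Type*} [Fintype A]
    (r : X → A → ℝ) (π : X → A → ℝ) : X → ℝ :=
  fun x => ∑ a, π x a * r x a

/-- The value function `V^π_{P,r} = (1 - γ • P_π)⁻¹ *ᵥ r_π`. -/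
noncomputable def valueFn {X A : Type*} [Fintype X] [DecidableEq X] [Fintype A]
    (γ : ℝ) (P : X → A → X → ℝ) (r : X → A → ℝ) (π : X → A → ℝ) : X → ℝ :=
  ((1 : Matrix X X ℝ) - γ • polMat P π)⁻¹ *ᵥ polRew r π

/-- The return `ρ(π, P, r) = ∑ x, p0 x * V^π_{P,r} x`. -/
noncomputable def ret {X A : Type*} [Fintype X] [DecidableEq X] [Fintype A]
    (p0 : X → ℝ) (γ : ℝ) (P : X → A → X → ℝ) (r : X → A → ℝ) (π : X → A → ℝ) : ℝ :=
  ∑ x, p0 x * valueFn γ P r π x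

/-- A transition kernel: nonnegative entries, each row summing to one. -/
def IsKernel {X A : Type*} [Fintype X] (P : X → A → X → ℝ) : Prop :=
  (∀ x a x', 0 ≤ P x a x') ∧ ∀ x a, ∑ x', P x a x' = 1

/-- A randomized stationary policy. -/
def IsPolicy {X A : Type*} [Fintype A] (π : X → A → ℝ) : Prop :=
  (∀ x a, 0 ≤ π x a) ∧ ∀ x, ∑ a, π x a = 1

/-- The error function `e_π x = ∑ a, π x a * e x a` induced by a policy. -/
noncomputable def polErr {X A : Type*} [Fintype A]
    (e : X → A → ℝ) (π : X → A → ℝ) : X → ℝ :=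
  fun x => ∑ a, π x a * e x a

/-- The normalized state occupancy frequency
`u^π_P x = (1 - γ) * ∑ y, p0 y * ((1 - γ • P_π)⁻¹) y x`. -/
noncomputable def occupancy {X A : Type*} [Fintype X] [DecidableEq X] [Fintype A]
    (p0 : X → ℝ) (γ : ℝ) (P : X → A → X → ℝ) (π : X → A → ℝ) : X → ℝ :=
  fun x => (1 - γ) * ∑ y, p0 y * ((1 : Matrix X X ℝ) - γ • polMat P π)⁻¹ y x

/-- The robust return of a policy: the infimum of its returns over all kernels in
the uncertainty set `U(P̂, e)`. -/
noncomputable def robustRet {X A : Type*} [Fintype X] [DecidableEq X] [Fintype A]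
    (p0 : X → ℝ) (γ : ℝ) (Phat : X → A → X → ℝ) (e : X → A → ℝ)
    (r : X → A → ℝ) (π : X → A → ℝ) : ℝ :=
  sInf {v : ℝ | ∃ P : X → A → X → ℝ, IsKernel P ∧
    (∀ x a, ∑ x', |P x a x' - Phat x a x'| ≤ e x a) ∧ v = ret p0 γ P r π}

/-- Minimum principle for `1 - γ P` with `P` row-stochastic. -/
lemma aux_min {X : Type*} [Fintype X] [Nonempty X] [DecidableEq X]
    (γ : ℝ) (hγ0 : 0 ≤ γ) (Q : Matrix X X ℝ) (hQ : ∀ x y, 0 ≤ Q x y)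
    (hQ1 : ∀ x, ∑ y, Q x y = 1) (hγ1 : γ < 1) (v : X → ℝ) (c : ℝ)
    (h : ∀ x, c ≤ (((1 : Matrix X X ℝ) - γ • Q) *ᵥ v) x) (x : X) :
    c ≤ (1 - γ) * v x := by
  obtain ⟨x0, hx0⟩ := Finite.exists_min v
  have h1 := h x0
  rw [Matrix.sub_mulVec, Matrix.one_mulVec, Matrix.smul_mulVec] at h1
  simp only [Pi.sub_apply, Pi.smul_apply, smul_eq_mul] at h1
  have h2 : v x0 ≤ (Q *ᵥ v) x0 := by
    calc v x0 = ∑ y, Q x0 y * v x0 := by rw [← Finset.sum_mul, hQ1, one_mul]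
      _ ≤ ∑ y, Q x0 y * v y :=
        Finset.sum_le_sum fun y _ => mul_le_mul_of_nonneg_left (hx0 y) (hQ x0 y)
      _ = (Q *ᵥ v) x0 := rfl
  have h3 := mul_le_mul_of_nonneg_left h2 hγ0
  have h4 := mul_le_mul_of_nonneg_left (hx0 x) (sub_nonneg.2 hγ1.le)
  linarith

lemma aux_unit {X : Type*} [Fintype X] [Nonempty X] [DecidableEq X]
    (γ : ℝ) (hγ0 : 0 ≤ γ) (Q : Matrix X X ℝ) (hQ : ∀ x y, 0 ≤ Q x y)
    (hQ1 : ∀ x, ∑ y, Q x y = 1) (hγ1 : γ < 1) :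
    IsUnit ((1 : Matrix X X ℝ) - γ • Q).det := by
  rw [← Matrix.isUnit_iff_isUnit_det, ← Matrix.mulVec_injective_iff_isUnit]
  have key : ∀ v w : X → ℝ, ((1 : Matrix X X ℝ) - γ • Q) *ᵥ v = ((1 : Matrix X X ℝ) - γ • Q) *ᵥ w →
      ∀ x, w x ≤ v x := by
    intro v w h x
    have := aux_min γ hγ0 Q hQ hQ1 hγ1 (v - w) 0
      (fun x => by rw [Matrix.mulVec_sub, h, sub_self]; simp) x
    have h5 := nonneg_of_mul_nonneg_right this (sub_pos.2 hγ1)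
    simpa using h5
  intro v w h
  ext x
  exact le_antisymm (key w v h.symm x) (key v w h x)

lemma aux_inv {X : Type*} [Fintype X] [Nonempty X] [DecidableEq X]
    (γ : ℝ) (hγ0 : 0 ≤ γ) (Q : Matrix X X ℝ) (hQ : ∀ x y, 0 ≤ Q x y)
    (hQ1 : ∀ x, ∑ y, Q x y = 1) (hγ1 : γ < 1) (v : X → ℝ) :
    ((1 : Matrix X X ℝ) - γ • Q) *ᵥ (((1 : Matrix X X ℝ) - γ • Q)⁻¹ *ᵥ v) = v := by
  rw [Matrix.mulVec_mulVec, Matrix.mul_nonsing_inv _ (aux_unit γ hγ0 Q hQ hQ1 hγ1),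
    Matrix.one_mulVec]

lemma polMat_nonneg {X A : Type*} [Fintype X] [Fintype A] {P : X → A → X → ℝ} {π : X → A → ℝ}
    (hP : IsKernel P) (hπ : IsPolicy π) (x y : X) : 0 ≤ polMat P π x y := by
  simp only [polMat, Matrix.of_apply]
  exact Finset.sum_nonneg fun a _ => mul_nonneg (hπ.1 x a) (hP.1 x a y)

lemma polMat_sum {X A : Type*} [Fintype X] [Fintype A] {P : X → A → X → ℝ} {π : X → A → ℝ}
    (hP : IsKernel P) (hπ : IsPolicy π) (x : X) : ∑ y, polMat P π x y = 1 := by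
  simp only [polMat, Matrix.of_apply]
  rw [Finset.sum_comm]
  simp_rw [← Finset.mul_sum, hP.2, mul_one, hπ.2]

lemma polRew_abs {X A : Type*} [Fintype A] {r : X → A → ℝ} {π : X → A → ℝ} {R : ℝ}
    (hr : ∀ x a, |r x a| ≤ R) (hπ : IsPolicy π) (x : X) : |polRew r π x| ≤ R := by
  unfold polRew
  calc |∑ a, π x a * r x a| ≤ ∑ a, |π x a * r x a| := Finset.abs_sum_le_sum_abs _ _
    _ ≤ ∑ a, π x a * R := Finset.sum_le_sum fun a _ => by
        rw [abs_mul, abs_of_nonneg (hπ.1 x a)]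
        exact mul_le_mul_of_nonneg_left (hr x a) (hπ.1 x a)
    _ = R := by rw [← Finset.sum_mul, hπ.2, one_mul]

lemma valueFn_abs {X A : Type*} [Fintype X] [Nonempty X] [DecidableEq X] [Fintype A]
    {γ : ℝ} (hγ0 : 0 ≤ γ) (hγ1 : γ < 1) {R : ℝ} {r : X → A → ℝ} (hr : ∀ x a, |r x a| ≤ R)
    {P : X → A → X → ℝ} {π : X → A → ℝ} (hP : IsKernel P) (hπ : IsPolicy π) (x : X) :
    |valueFn γ P r π x| ≤ R / (1 - γ) := by
  have hpos : 0 < 1 - γ := sub_pos.2 hγ1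
  have hV := aux_inv γ hγ0 _ (polMat_nonneg hP hπ) (polMat_sum hP hπ) hγ1 (polRew r π)
  change _ *ᵥ (valueFn γ P r π) = _ at hV
  have h1 := aux_min γ hγ0 _ (polMat_nonneg hP hπ) (polMat_sum hP hπ) hγ1 (valueFn γ P r π) (-R)
    (fun x => by rw [hV]; exact (abs_le.1 (polRew_abs hr hπ x)).1) x
  have h2 := aux_min γ hγ0 _ (polMat_nonneg hP hπ) (polMat_sum hP hπ) hγ1 (-valueFn γ P r π) (-R)
    (fun x => by
      rw [Matrix.mulVec_neg, hV, Pi.neg_apply]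
      exact neg_le_neg (abs_le.1 (polRew_abs hr hπ x)).2) x
  rw [Pi.neg_apply] at h2
  rw [le_div_iff₀ hpos, ← abs_of_pos hpos, ← abs_mul, abs_le]
  constructor <;> linarith

lemma ret_diff {X A : Type*} [Fintype X] [Nonempty X] [DecidableEq X] [Fintype A]
    {γ : ℝ} (hγ0 : 0 ≤ γ) (hγ1 : γ < 1) {R : ℝ} (hR : 0 ≤ R)
    {r : X → A → ℝ} (hr : ∀ x a, |r x a| ≤ R)
    {p0 : X → ℝ} (hp0 : ∀ x, 0 ≤ p0 x)
    {Q P H : X → A → X → ℝ} (hQ : IsKernel Q) (hP : IsKernel P) {e : X → A → ℝ}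
    (hQH : ∀ x a, ∑ x', |Q x a x' - H x a x'| ≤ e x a)
    (hPH : ∀ x a, ∑ x', |P x a x' - H x a x'| ≤ e x a)
    {π : X → A → ℝ} (hπ : IsPolicy π) :
    ret p0 γ Q r π - ret p0 γ P r π ≤
      2 * γ * R / (1 - γ) ^ 2 * ∑ x, occupancy p0 γ Q π x * polErr e π x := by
  have hpos : 0 < 1 - γ := sub_pos.2 hγ1
  have hVQ := aux_inv γ hγ0 _ (polMat_nonneg hQ hπ) (polMat_sum hQ hπ) hγ1 (polRew r π)
  have hVP := aux_inv γ hγ0 _ (polMat_nonneg hP hπ) (polMat_sum hP hπ) hγ1 (polRew r π)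
  change _ *ᵥ (valueFn γ Q r π) = _ at hVQ
  change _ *ᵥ (valueFn γ P r π) = _ at hVP
  have hV := valueFn_abs hγ0 hγ1 hr hP hπ
  set VQ := valueFn γ Q r π with hVQd
  set VP := valueFn γ P r π with hVPd
  set w : X → ℝ := fun x => γ * (2 * polErr e π x * (R / (1 - γ))) with hw
  have hW := aux_inv γ hγ0 _ (polMat_nonneg hQ hπ) (polMat_sum hQ hπ) hγ1 w
  have hrow : ∀ x, (polMat Q π *ᵥ VP) x - (polMat P π *ᵥ VP) x ≤
      2 * polErr e π x * (R / (1 - γ)) := by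
    intro x
    have e1 : (polMat Q π *ᵥ VP) x - (polMat P π *ᵥ VP) x =
        ∑ a, π x a * ∑ y, (Q x a y - P x a y) * VP y := by
      simp only [Matrix.mulVec, dotProduct, polMat, Matrix.of_apply]
      rw [← Finset.sum_sub_distrib]
      simp_rw [Finset.mul_sum]
      rw [Finset.sum_comm]
      refine Finset.sum_congr rfl fun y _ => ?_
      rw [← sub_mul, ← Finset.sum_sub_distrib, Finset.sum_mul]
      exact Finset.sum_congr rfl fun a _ => by ring
    have e2 : 2 * polErr e π x * (R / (1 - γ)) = ∑ a, π x a * (2 * e x a * (R / (1 - γ))) := by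
      unfold polErr
      rw [Finset.mul_sum, Finset.sum_mul]
      exact Finset.sum_congr rfl fun a _ => by ring
    rw [e1, e2]
    refine Finset.sum_le_sum fun a _ => mul_le_mul_of_nonneg_left ?_ (hπ.1 x a)
    calc ∑ y, (Q x a y - P x a y) * VP y
        ≤ ∑ y, (|Q x a y - H x a y| + |P x a y - H x a y|) * (R / (1 - γ)) := by
          refine Finset.sum_le_sum fun y _ => (le_abs_self _).trans ?_
          rw [abs_mul]
          refine mul_le_mul ?_ (hV y) (abs_nonneg _) (by positivity)
          rw [abs_sub_comm (P x a y)]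
          exact abs_sub_le _ _ _
      _ = (∑ y, |Q x a y - H x a y| + ∑ y, |P x a y - H x a y|) * (R / (1 - γ)) := by
          rw [← Finset.sum_mul, Finset.sum_add_distrib]
      _ ≤ 2 * e x a * (R / (1 - γ)) := by
          refine mul_le_mul_of_nonneg_right ?_ (div_nonneg hR hpos.le)
          linarith [hQH x a, hPH x a]
  set M := (1 : Matrix X X ℝ) - γ • polMat Q π with hM
  have hD : ∀ x, VQ x - VP x ≤ (M⁻¹ *ᵥ w) x := by
    intro x
    have h0 := aux_min γ hγ0 _ (polMat_nonneg hQ hπ) (polMat_sum hQ hπ) hγ1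
      (M⁻¹ *ᵥ w - (VQ - VP)) 0 (fun x => by
        rw [← hM, Matrix.mulVec_sub, Matrix.mulVec_sub, hW, hVQ, ← hVP, hM,
          Matrix.sub_mulVec, Matrix.sub_mulVec, Matrix.smul_mulVec, Matrix.smul_mulVec]
        simp only [Pi.sub_apply, Pi.smul_apply, smul_eq_mul, hw]
        have := mul_le_mul_of_nonneg_left (hrow x) hγ0
        linarith) x
    have h5 := nonneg_of_mul_nonneg_right h0 hpos
    simp only [Pi.sub_apply] at h5
    linarith
  calc ret p0 γ Q r π - ret p0 γ P r π = ∑ x, p0 x * (VQ x - VP x) := by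
        simp only [ret, mul_sub, Finset.sum_sub_distrib, hVQd, hVPd]
    _ ≤ ∑ x, p0 x * (M⁻¹ *ᵥ w) x :=
        Finset.sum_le_sum fun x _ => mul_le_mul_of_nonneg_left (hD x) (hp0 x)
    _ = _ := by
        simp only [Matrix.mulVec, dotProduct, occupancy, Finset.mul_sum, Finset.sum_mul, ← hM]
        rw [Finset.sum_comm]
        refine Finset.sum_congr rfl fun x _ => Finset.sum_congr rfl fun y _ => ?_
        simp only [hw]
        field_simp

/-- Theorem 3: safety and performance loss of the robust solution. -/
theorem robust_safe_and_perf_loss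
    {X A : Type*} [Fintype X] [Nonempty X] [DecidableEq X] [Fintype A] [Nonempty A]
    (γ : ℝ) (hγ0 : 0 ≤ γ) (hγ1 : γ < 1)
    (Rmax : ℝ) (hR : 0 ≤ Rmax)
    (r : X → A → ℝ) (hr : ∀ x a, |r x a| ≤ Rmax)
    (p0 : X → ℝ) (hp0 : ∀ x, 0 ≤ p0 x) (hp1 : ∑ x, p0 x = 1)
    (Pstar Phat : X → A → X → ℝ) (hPstar : IsKernel Pstar) (hPhat : IsKernel Phat)
    (e : X → A → ℝ)
    (hAsm : ∀ x a, ∑ x', |Pstar x a x' - Phat x a x'| ≤ e x a)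
    (π0 : X → A → ℝ) (hπ0 : IsPolicy π0)
    (hπ0opt : ∀ π : X → A → ℝ, IsPolicy π →
      robustRet p0 γ Phat e r π ≤ robustRet p0 γ Phat e r π0)
    (πstar : X → A → ℝ) (hπstar : IsPolicy πstar)
    (hπstaropt : ∀ π : X → A → ℝ, IsPolicy π → ret p0 γ Pstar r π ≤ ret p0 γ Pstar r πstar)
    (πB : X → A → ℝ) (hπB : IsPolicy πB)
    (hcond : robustRet p0 γ Phat e r π0 > ret p0 γ Pstar r πB) :
    ret p0 γ Pstar r π0 ≥ ret p0 γ Pstar r πB ∧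
      ret p0 γ Pstar r πstar - ret p0 γ Pstar r π0 ≤
        min (2 * γ * Rmax / (1 - γ) ^ 2 * ∑ x, occupancy p0 γ Pstar πstar x * polErr e πstar x)
          (ret p0 γ Pstar r πstar - ret p0 γ Pstar r πB) := by
  have hlow : ∀ π : X → A → ℝ, IsPolicy π → ∀ v ∈ {v : ℝ | ∃ P : X → A → X → ℝ, IsKernel P ∧
      (∀ x a, ∑ x', |P x a x' - Phat x a x'| ≤ e x a) ∧ v = ret p0 γ P r π},
      ret p0 γ Pstar r π -
        2 * γ * Rmax / (1 - γ) ^ 2 * ∑ x, occupancy p0 γ Pstar π x * polErr e π x ≤ v := by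
    rintro π hπ v ⟨P, hP, hPe, rfl⟩
    linarith [ret_diff hγ0 hγ1 hR hr hp0 hPstar hP hAsm hPe hπ]
  have h1 : robustRet p0 γ Phat e r π0 ≤ ret p0 γ Pstar r π0 :=
    csInf_le ⟨_, hlow π0 hπ0⟩ ⟨Pstar, hPstar, hAsm, rfl⟩
  have h2 : ret p0 γ Pstar r πstar - 2 * γ * Rmax / (1 - γ) ^ 2 *
      ∑ x, occupancy p0 γ Pstar πstar x * polErr e πstar x ≤ robustRet p0 γ Phat e r πstar :=
    le_csInf ⟨_, Pstar, hPstar, hAsm, rfl⟩ (hlow πstar hπstar)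
  have h3 := hπ0opt πstar hπstar
  refine ⟨by linarith, le_min (by linarith) (by linarith)⟩
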